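/- Consider two PFCT-S instances sharing the same sources [n], supplies a_1, …, a_n ∈ ℤ_{>0}, and costs f_1 ≥ f_2 ≥ … ≥ f_n ≥ 0. The first instance has m sinks with demands b_1 ≥ … ≥ b_m > 0 and the second has m' sinks with demands b'_1 ≥ … ≥ b'_{m'} > 0, where both demand vectors sum to a_1 + … + a_n. For t ∈ (0, a_1+…+a_n], let π(t) be the smallest j with b_1 + … + b_j ≥ t, and π'(t) the smallest j with b'_1 + … + b'_j ≥ t. Suppose π'(t) ≤ π(t) + Δ for some integer Δ ≥ 0 and all t ∈ (0, a_1+…+a_n]. Then the cost of the northwest-corner (greedy) solution to the second instance is at most cost_f(x) + Δ·f_1 + ∑_{i=2}^{n} f_i for every feasible solution x of the first instance; in particular, it is at most the optimum of the first instance plus Δ·f_1 + ∑_{i=2}^{n} f_i. -/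

import Mathlib

open Finset

/-- Sum of the first `t` entries of a vector indexed by `Fin k`. -/
def partialSum {k : ℕ} (c : Fin k → ℤ) (t : ℕ) : ℤ :=
  ∑ i : Fin k, if (i : ℕ) < t then c i else 0

/-- `π(t)`: the smallest `j` such that the first `j` sinks have total demand at least `t`. -/
noncomputable def piFn {m : ℕ} (b : Fin m → ℤ) (t : ℝ) : ℕ :=
  sInf {k : ℕ | t ≤ (partialSum b k : ℝ)}

/-- Extension of the cost vector with `f_{n+1} = 0`. -/
noncomputable def fext {n : ℕ} (f : Fin n → ℝ) (k : ℕ) : ℝ :=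
  if h : k < n then f ⟨k, h⟩ else 0

/-- PFCT-S cost of a solution `x`: `∑_{(i,j) : x_{ij} > 0} f_i`. -/
noncomputable def costF {n m : ℕ} (f : Fin n → ℝ) (x : Fin n → Fin m → ℝ) : ℝ :=
  ∑ i : Fin n, ∑ j : Fin m, if 0 < x i j then f i else 0

/-- The northwest-corner (greedy) solution. -/
def greedy {n m : ℕ} (a : Fin n → ℤ) (b : Fin m → ℤ) : Fin n → Fin m → ℝ :=
  fun i j =>
    max 0 (min ((partialSum a ((i : ℕ) + 1) : ℤ) : ℝ) ((partialSum b ((j : ℕ) + 1) : ℤ) : ℝ)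
      - max ((partialSum a (i : ℕ) : ℤ) : ℝ) ((partialSum b (j : ℕ) : ℤ) : ℝ))

theorem sum_mul_nonneg_of_antitone {n : ℕ} (f u : Fin n → ℝ)
    (hf : ∀ i j : Fin n, i ≤ j → f j ≤ f i)
    (hu : ∀ k ≤ n, 0 ≤ ∑ i : Fin n with i.val < k, u i)
    (c : ℝ) (hc : ∀ i, c ≤ f i) :
    c * ∑ i, u i ≤ ∑ i, f i * u i := by
  induction n generalizing c with
  | zero => simp
  | succ n ih =>
    have hprefix : ∀ k ≤ n, 0 ≤ ∑ i : Fin n with i.val < k, u i.castSucc := by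
      intro k hk
      have h := hu k (by omega)
      rw [sum_filter, Fin.sum_univ_castSucc] at h
      rw [sum_filter]
      simpa [Nat.not_lt.mpr hk] using h
    have hind := ih (fun i => f i.castSucc) (fun i => u i.castSucc)
      (fun i j hij => hf _ _ (by simpa using hij)) hprefix (f (Fin.last n))
      (fun i => hf _ _ (Fin.le_last _))
    have htotal : 0 ≤ ∑ i, u i := by
      have h := hu (n + 1) le_rfl
      rwa [filter_true_of_mem (fun i _ => i.isLt)] at h
    calc c * ∑ i, u i ≤ f (Fin.last n) * ∑ i, u i :=
          mul_le_mul_of_nonneg_right (hc _) htotal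
      _ ≤ ∑ i, f i * u i := by
          rw [Fin.sum_univ_castSucc, Fin.sum_univ_castSucc (fun i => f i * u i)]
          linarith

theorem sum_mul_le_sum_mul_of_prefix_le {n : ℕ} (f u v : Fin n → ℝ)
    (hf0 : ∀ i, 0 ≤ f i) (hf : ∀ i j : Fin n, i ≤ j → f j ≤ f i)
    (huv : ∀ k ≤ n, ∑ i : Fin n with i.val < k, u i ≤ ∑ i : Fin n with i.val < k, v i) :
    ∑ i, f i * u i ≤ ∑ i, f i * v i := by
  have h := sum_mul_nonneg_of_antitone f (fun i => v i - u i) hf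
    (fun k hk => by simpa using huv k hk) 0 hf0
  simp only [zero_mul, mul_sub, sum_sub_distrib] at h
  linarith

theorem partialSum_eq_sum_filter {k : ℕ} (c : Fin k → ℤ) (t : ℕ) :
    partialSum c t = ∑ i : Fin k with i.val < t, c i := by
  rw [partialSum, sum_filter]

theorem partialSum_zero {k : ℕ} (c : Fin k → ℤ) : partialSum c 0 = 0 := by
  simp [partialSum]

theorem partialSum_eq_sum {k : ℕ} (c : Fin k → ℤ) : partialSum c k = ∑ i, c i := by
  simp [partialSum]

theorem partialSum_mono {k : ℕ} {c : Fin k → ℤ} (hc : ∀ i, 0 < c i) : Monotone (partialSum c) := by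
  intro s t hst
  rw [partialSum_eq_sum_filter, partialSum_eq_sum_filter]
  refine sum_le_sum_of_subset_of_nonneg ?_ (fun i _ _ => (hc i).le)
  intro i hi
  simp only [mem_filter, mem_univ, true_and] at hi ⊢
  omega

theorem partialSum_le_sum {k : ℕ} {c : Fin k → ℤ} (hc : ∀ i, 0 < c i) (t : ℕ) :
    partialSum c t ≤ ∑ i, c i := by
  rw [partialSum_eq_sum_filter]
  exact sum_le_sum_of_subset_of_nonneg (filter_subset _ _) (fun i _ _ => (hc i).le)

theorem partialSum_pos {k t : ℕ} {c : Fin k → ℤ} (hc : ∀ i, 0 < c i) (hk : 0 < k) (ht : 0 < t) :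
    0 < partialSum c t := by
  rw [partialSum_eq_sum_filter]
  exact sum_pos (fun i _ => hc i) ⟨⟨0, hk⟩, by simpa using ht⟩

theorem piFn_le_iff {m : ℕ} {b : Fin m → ℤ} (hb : ∀ j, 0 < b j) {t : ℝ}
    (ht : t ≤ ((∑ j, b j : ℤ) : ℝ)) (k : ℕ) :
    piFn b t ≤ k ↔ t ≤ (partialSum b k : ℝ) := by
  constructor
  · intro h
    have hmem : piFn b t ∈ {k : ℕ | t ≤ (partialSum b k : ℝ)} :=
      Nat.sInf_mem ⟨m, by rw [Set.mem_ofPred_eq, partialSum_eq_sum]; exact ht⟩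
    have hmono : (partialSum b (piFn b t) : ℝ) ≤ partialSum b k := by
      exact_mod_cast partialSum_mono hb h
    exact le_trans hmem hmono
  · intro h
    exact Nat.sInf_le h

theorem piFn_zero {m : ℕ} (b : Fin m → ℤ) : piFn b 0 = 0 :=
  Nat.le_zero.mp (Nat.sInf_le (by simp [partialSum_zero]))

/-- Among all sets of sinks of a given size, the initial segment has the largest demand. -/
theorem sum_le_partialSum_card {m : ℕ} {b : Fin m → ℤ} (hb : ∀ j, 0 < b j)
    (hbmono : ∀ j j' : Fin m, j ≤ j' → b j' ≤ b j) (J : Finset (Fin m)) :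
    ∑ j ∈ J, b j ≤ partialSum b J.card := by
  have h := sum_mul_le_sum_mul_of_prefix_le (fun j => (b j : ℝ))
    (fun j => if j ∈ J then 1 else 0) (fun j => if (j : ℕ) < J.card then 1 else 0)
    (fun j => by exact_mod_cast (hb j).le) (fun i j hij => by exact_mod_cast hbmono i j hij) ?_
  · have h' : ((∑ j ∈ J, b j : ℤ) : ℝ) ≤ (partialSum b J.card : ℝ) := by
      simpa [partialSum] using h
    exact_mod_cast h'
  · intro k hk
    rw [sum_boole, sum_boole, filter_filter, filter_filter]
    have hcard : ∀ s : ℕ, s ≤ m → #{i : Fin m | (i : ℕ) < s} = s := by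
      intro s hs
      rw [Fin.card_filter_val_lt, min_eq_right hs]
    have hJ : J.card ≤ m := by simpa using card_le_univ J
    norm_cast
    rcases le_total k J.card with hkJ | hkJ
    · calc _ ≤ #{i : Fin m | (i : ℕ) < k} :=
            card_le_card (fun i => by simp +contextual)
        _ ≤ _ := card_le_card (fun i => by
            simp only [mem_filter, mem_univ, true_and]; omega)
    · calc _ ≤ J.card := card_le_card (fun i => by simp +contextual)
        _ = #{i : Fin m | (i : ℕ) < J.card} := (hcard _ hJ).symm
        _ ≤ _ := card_le_card (fun i => by
            simp only [mem_filter, mem_univ, true_and]; omega)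

theorem costF_eq_sum_mul_card {n m : ℕ} (f : Fin n → ℝ) (x : Fin n → Fin m → ℝ) :
    costF f x = ∑ i, f i * (#{j | 0 < x i j} : ℝ) := by
  refine sum_congr rfl fun i _ => ?_
  rw [← sum_filter, sum_const, nsmul_eq_mul, mul_comm]

/-- The first `k` sources of a feasible solution use at least `π(A_k)` arcs. -/
theorem piFn_le_sum_card {n m : ℕ} {a : Fin n → ℤ} (ha : ∀ i, 0 < a i)
    {b : Fin m → ℤ} (hb : ∀ j, 0 < b j) (hbmono : ∀ j j' : Fin m, j ≤ j' → b j' ≤ b j)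
    (hab : ∑ i, a i = ∑ j, b j) {x : Fin n → Fin m → ℝ} (hx_nonneg : ∀ i j, 0 ≤ x i j)
    (hx_row : ∀ i, ∑ j, x i j = (a i : ℝ)) (hx_col : ∀ j, ∑ i, x i j = (b j : ℝ)) (k : ℕ) :
    piFn b (partialSum a k) ≤ ∑ i : Fin n with i.val < k, #{j | 0 < x i j} := by
  set J : Finset (Fin m) :=
    ({i : Fin n | (i : ℕ) < k} : Finset (Fin n)).biUnion (fun i => {j | 0 < x i j}) with hJ
  refine le_trans ?_ (card_biUnion_le (s := {i : Fin n | (i : ℕ) < k})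
    (t := fun i => ({j | 0 < x i j} : Finset (Fin m))))
  rw [← hJ, piFn_le_iff hb (by exact_mod_cast hab ▸ partialSum_le_sum ha k)]
  calc (partialSum a k : ℝ) = ∑ i : Fin n with i.val < k, ∑ j, x i j := by
        rw [partialSum_eq_sum_filter]; push_cast
        exact sum_congr rfl fun i _ => (hx_row i).symm
    _ = ∑ i : Fin n with i.val < k, ∑ j ∈ J, x i j := by
        refine sum_congr rfl fun i hi => (sum_subset (subset_univ _) fun j _ hj => ?_).symm
        refine le_antisymm (not_lt.mp fun hpos => hj ?_) (hx_nonneg i j)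
        exact mem_biUnion.mpr ⟨i, hi, by simpa using hpos⟩
    _ = ∑ j ∈ J, ∑ i : Fin n with i.val < k, x i j := sum_comm
    _ ≤ ∑ j ∈ J, ∑ i, x i j := sum_le_sum fun j _ =>
        sum_le_sum_of_subset_of_nonneg (filter_subset _ _) fun i _ _ => hx_nonneg i j
    _ = ((∑ j ∈ J, b j : ℤ) : ℝ) := by
        push_cast
        exact sum_congr rfl fun j _ => hx_col j
    _ ≤ (partialSum b J.card : ℝ) := by exact_mod_cast sum_le_partialSum_card hb hbmono J

/-- The number of sinks served by source `i` in the greedy solution. -/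
theorem card_greedy_add_piFn_le {n m : ℕ} {a : Fin n → ℤ} (ha : ∀ i, 0 < a i)
    {b : Fin m → ℤ} (hb : ∀ j, 0 < b j) (hab : ∑ i, a i = ∑ j, b j) (i : Fin n) :
    #{j | 0 < greedy a b i j} + piFn b (partialSum a i) ≤
      piFn b (partialSum a (i + 1)) + if (i : ℕ) = 0 then 0 else 1 := by
  have hle : ∀ k, (partialSum a k : ℝ) ≤ ((∑ j, b j : ℤ) : ℝ) := fun k => by
    exact_mod_cast hab ▸ partialSum_le_sum ha k
  set p := piFn b (partialSum a i) with hp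
  set q := piFn b (partialSum a (i + 1)) with hq
  have hpq : p ≤ q := by
    rw [hp, piFn_le_iff hb (hle _)]
    refine le_trans ?_ ((piFn_le_iff hb (hle _) _).mp hq.ge)
    exact_mod_cast partialSum_mono ha (Nat.le_succ _)
  have hsub : ({j | 0 < greedy a b i j} : Finset (Fin m)).map Fin.valEmbedding ⊆
      Ico (p - 1) q := by
    intro j hj
    simp only [mem_map, mem_filter, mem_univ, true_and, Fin.valEmbedding_apply] at hj
    obtain ⟨j, hpos, rfl⟩ := hj
    simp only [greedy, lt_max_iff, lt_irrefl, false_or, sub_pos, max_lt_iff, lt_min_iff] at hpos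
    have h1 : p ≤ j + 1 := (piFn_le_iff hb (hle _) _).mpr hpos.2.1.le
    have h2 : ¬ q ≤ j := fun h => absurd ((piFn_le_iff hb (hle _) _).mp h) (not_le.mpr hpos.1.2)
    rw [mem_Ico]
    omega
  have hcard := card_le_card hsub
  rw [card_map, Nat.card_Ico] at hcard
  split_ifs with hi
  · have : p = 0 := by rw [hp, hi, partialSum_zero, Int.cast_zero, piFn_zero]
    omega
  · have : p ≠ 0 := by
      intro h
      have h0 := (piFn_le_iff hb (hle _) 0).mp (hp ▸ h).le
      rw [partialSum_zero] at h0
      have := partialSum_pos ha i.pos (Nat.pos_of_ne_zero hi)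
      norm_cast at h0
      omega
    omega

theorem sum_filter_val_lt_succ {M : Type*} [AddCommMonoid M] {n k : ℕ} (hk : k < n)
    (g : Fin n → M) :
    ∑ i : Fin n with i.val < k + 1, g i =
      g ⟨k, hk⟩ + ∑ i : Fin n with i.val < k, g i := by
  have : ({i : Fin n | (i : ℕ) < k + 1} : Finset (Fin n)) =
      insert ⟨k, hk⟩ ({i : Fin n | (i : ℕ) < k} : Finset (Fin n)) := by
    ext i
    simp only [mem_filter, mem_univ, true_and, mem_insert, Fin.ext_iff]
    omega
  rw [this, sum_insert (by simp)]

theorem sum_card_greedy_le {n m : ℕ} {a : Fin n → ℤ} (ha : ∀ i, 0 < a i)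
    {b : Fin m → ℤ} (hb : ∀ j, 0 < b j) (hab : ∑ i, a i = ∑ j, b j) (k : ℕ) (hk : k ≤ n) :
    ∑ i : Fin n with i.val < k, #{j | 0 < greedy a b i j} ≤
      piFn b (partialSum a k) + ∑ i : Fin n with i.val < k, if (i : ℕ) = 0 then 0 else 1 := by
  induction k with
  | zero => simp
  | succ k ih =>
    rw [sum_filter_val_lt_succ hk, sum_filter_val_lt_succ hk]
    have h1 := ih (by omega)
    have h2 := card_greedy_add_piFn_le ha hb hab ⟨k, hk⟩
    simp only at h2 ⊢
    omega

theorem sum_Ico_fext {n : ℕ} (f : Fin n → ℝ) :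
    ∑ i ∈ Ico 1 n, fext f i = ∑ i : Fin n, f i * if (i : ℕ) = 0 then 0 else 1 := by
  have h : ∀ i : Fin n, (f i * if (i : ℕ) = 0 then 0 else 1) =
      (fun k : ℕ => if k = 0 then 0 else fext f k) i := by
    intro i
    by_cases hi : (i : ℕ) = 0 <;> simp [fext, hi]
  rw [sum_congr rfl fun i _ => h i,
    Fin.sum_univ_eq_sum_range (fun k : ℕ => if k = 0 then 0 else fext f k) n]
  refine sum_subset_zero_on_sdiff (fun i => ?_) (fun i hi => ?_) (fun i hi => ?_)
  · simp
  · simp only [mem_sdiff, mem_range, mem_Ico] at hi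
    rw [if_pos (by omega)]
  · rw [mem_Ico] at hi
    rw [if_neg (by omega)]

/-- comparing two PFCT-S instances with the same sources, supplies and costs.
If `π'(t) ≤ π(t) + Δ` for every `t ∈ (0, a([n])]`, then the greedy solution of the second
instance costs at most `cost_f(x) + Δ·f_1 + ∑_{i=2}^n f_i` for every feasible `x` of the
first instance (in particular, at most the optimum of the first instance plus that term). -/
theorem stmt_4
    (n m m' : ℕ) (hn : 0 < n) (hm : 0 < m) (hm' : 0 < m')
    (a : Fin n → ℤ) (ha : ∀ i, 0 < a i)
    (f : Fin n → ℝ) (hf0 : ∀ i, 0 ≤ f i)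
    (hfmono : ∀ i i' : Fin n, i ≤ i' → f i' ≤ f i)
    (b : Fin m → ℤ) (hb : ∀ j, 0 < b j)
    (hbmono : ∀ j j' : Fin m, j ≤ j' → b j' ≤ b j)
    (hab : ∑ i, a i = ∑ j, b j)
    (b' : Fin m' → ℤ) (hb' : ∀ j, 0 < b' j)
    (hbmono' : ∀ j j' : Fin m', j ≤ j' → b' j' ≤ b' j)
    (hab' : ∑ i, a i = ∑ j, b' j)
    (Δ : ℕ)
    (hπ : ∀ t : ℝ, 0 < t → t ≤ ((∑ i, a i : ℤ) : ℝ) → piFn b' t ≤ piFn b t + Δ)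
    (x : Fin n → Fin m → ℝ)
    (hx_nonneg : ∀ i j, 0 ≤ x i j)
    (hx_row : ∀ i, ∑ j, x i j = (a i : ℝ))
    (hx_col : ∀ j, ∑ i, x i j = (b j : ℝ)) :
    costF f (greedy a b') ≤
      costF f x + (Δ : ℝ) * f ⟨0, hn⟩ + ∑ i ∈ Finset.Ico 1 n, fext f i := by
  have key := sum_mul_le_sum_mul_of_prefix_le f
    (fun i => (#{j | 0 < greedy a b' i j} : ℝ))
    (fun i => (#{j | 0 < x i j} : ℝ) + (if i = ⟨0, hn⟩ then (Δ : ℝ) else 0) +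
      if (i : ℕ) = 0 then 0 else 1) hf0 hfmono ?_
  · simp only [mul_add, sum_add_distrib, mul_ite, mul_zero, sum_ite_eq', mem_univ, if_true] at key
    rw [costF_eq_sum_mul_card, costF_eq_sum_mul_card, sum_Ico_fext]
    simp only [mul_ite, mul_zero]
    linarith
  · intro k hk
    rcases Nat.eq_zero_or_pos k with rfl | hk0
    · simp
    have hg := sum_card_greedy_le ha hb' hab' k hk
    have hx := piFn_le_sum_card ha hb hbmono hab hx_nonneg hx_row hx_col k
    have hΔ := hπ (partialSum a k) (by exact_mod_cast partialSum_pos ha hn hk0)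
      (by exact_mod_cast partialSum_le_sum ha k)
    have hnat := hg.trans (Nat.add_le_add_right (hΔ.trans (Nat.add_le_add_right hx Δ)) _)
    have hreal := (Nat.cast_le (α := ℝ)).mpr hnat
    push_cast at hreal
    simpa [sum_add_distrib, sum_ite_eq', hk0] using hreal
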